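/- (Upper bound of Lemma 2, precise form.) In the Euclidean plane, let O, A, B be three non-collinear points, set m := dist O A and β := ∠ O A B (the angle at vertex A). Let ε > 0 with 2ε < m, set δ := arcsin(2ε/(m − 2ε)), and assume β + δ < π/2. Let p, q be points with dist p O ≤ ε and dist q A ≤ ε, and let v be a point with v ∉ line AB, v ≠ q, and v, p, q collinear (so the line through v and q passes through both ε-balls). Let N be the orthogonal projection of v onto the line AB, and let M be a point on the line AB that is collinear with v and q. If M ∈ segment from A to N and N ∈ segment from A to B, then dist v N ≤ dist A B · tan(β + δ). (The paper states this bound with δ replaced by 2ε/m, which is the small-ε approximation of δ = arcsin(2ε/(m − 2ε)).) -/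

import Mathlib

open EuclideanGeometry

open InnerProductGeometry in
/-- The angle between `x` and `y` is at most the angle under which the ball of radius `‖x - y‖`
around `y` is seen from the origin. -/
lemma InnerProductGeometry.angle_le_arcsin_norm_sub_div {V : Type*} [NormedAddCommGroup V]
    [InnerProductSpace ℝ V] {x y : V} (h : ‖x - y‖ < ‖y‖) :
    angle x y ≤ Real.arcsin (‖x - y‖ / ‖y‖) := by
  have hy : 0 < ‖y‖ := (norm_nonneg _).trans_lt h
  have hsq : ‖x - y‖ ^ 2 = ‖x‖ ^ 2 - 2 * (Real.cos (angle x y) * (‖x‖ * ‖y‖)) + ‖y‖ ^ 2 := by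
    rw [norm_sub_sq_real, cos_angle_mul_norm_mul_norm]
  have hcos : 0 < Real.cos (angle x y) := by
    by_contra! hc
    have := mul_nonneg (neg_nonneg.2 hc) (mul_nonneg (norm_nonneg x) hy.le)
    nlinarith [norm_nonneg (x - y), sq_nonneg ‖x‖]
  have hangle : angle x y ≤ Real.pi / 2 := by
    by_contra! hc
    exact hcos.not_ge (Real.cos_nonpos_of_pi_div_two_le_of_le hc.le
      (by linarith [angle_le_pi x y, Real.pi_pos]))
  rw [Real.le_arcsin_iff_sin_le' ⟨by linarith [angle_nonneg x y, Real.pi_pos], hangle⟩,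
    le_div_iff₀ hy]
  refine le_of_sq_le_sq ?_ (norm_nonneg _)
  nlinarith [sq_nonneg (‖x‖ - ‖y‖ * Real.cos (angle x y)), Real.sin_sq_add_cos_sq (angle x y)]

open InnerProductGeometry in
lemma InnerProductGeometry.inner_pos_of_angle_lt_pi_div_two {V : Type*} [NormedAddCommGroup V]
    [InnerProductSpace ℝ V] {x y : V} (h : angle x y < Real.pi / 2) : 0 < inner ℝ x y := by
  rw [angle, Real.arccos_lt_pi_div_two] at h
  exact pos_of_mul_pos_left (by simpa [div_eq_mul_inv] using h) (by positivity)

/-- If `p` and `M` lie on the line through the distinct points `v` and `q`, and `v ≠ M`, then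
`p -ᵥ q` is a multiple of `v -ᵥ M`. -/
lemma Collinear.exists_vsub_eq_smul_vsub {k V P : Type*} [Field k] [AddCommGroup V] [Module k V]
    [AddTorsor V P] {v p q M : P} (hvq : v ≠ q) (hvM : v ≠ M) (hp : Collinear k {v, p, q})
    (hM : Collinear k {v, q, M}) : ∃ c : k, p -ᵥ q = c • (v -ᵥ M) := by
  have h : Collinear k {v, M, p, q} := by
    have hp' := hp.mem_affineSpan_of_mem_of_ne (p₁ := v) (p₂ := q) (p₃ := p)
      (by simp) (by simp) (by simp) hvq
    have hM' := hM.mem_affineSpan_of_mem_of_ne (p₁ := v) (p₂ := q) (p₃ := M)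
      (by simp) (by simp) (by simp) hvq
    refine (collinear_insert_insert_of_mem_affineSpan_pair hM' hp').subset ?_
    intro x
    simp only [Set.mem_insert_iff, Set.mem_singleton_iff]
    tauto
  obtain ⟨d, hd⟩ := (collinear_iff_of_mem (p₀ := M) (by simp)).1 h
  obtain ⟨r, hr⟩ := hd v (by simp)
  obtain ⟨s, hs⟩ := hd p (by simp)
  obtain ⟨t, ht⟩ := hd q (by simp)
  have hr0 : r ≠ 0 := by
    rintro rfl
    exact hvM (by simpa using hr)
  refine ⟨(s - t) / r, ?_⟩
  rw [hs, ht, hr, vadd_vsub_vadd_cancel_right, vadd_vsub, smul_smul, div_mul_cancel₀ _ hr0,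
    sub_smul]

/-- Upper bound of Lemma 2, precise form: if the line through `v` and `q` passes through
the `ε`-balls at `O` and `A`, then the distance from `v` to its foot `N` on line `AB`
is at most `|AB| · tan (β + δ)` where `β = ∠ O A B` and `δ = arcsin (2ε / (m - 2ε))`. -/
theorem apex_distance_upper_bound (O A B p q v M N : EuclideanSpace ℝ (Fin 2))
    (hncol : ¬ Collinear ℝ ({O, A, B} : Set (EuclideanSpace ℝ (Fin 2))))
    (ε : ℝ) (hε : 0 < ε) (hm : 2 * ε < dist O A)
    (hβδ : ∠ O A B + Real.arcsin (2 * ε / (dist O A - 2 * ε)) < Real.pi / 2)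
    (hp : dist p O ≤ ε) (hq : dist q A ≤ ε)
    (hv : v ∉ affineSpan ℝ {A, B}) (hvq : v ≠ q)
    (hcol : Collinear ℝ ({v, p, q} : Set (EuclideanSpace ℝ (Fin 2))))
    (hN : N = EuclideanGeometry.orthogonalProjection (affineSpan ℝ {A, B}) v)
    (hMline : M ∈ affineSpan ℝ {A, B})
    (hMcol : Collinear ℝ ({v, q, M} : Set (EuclideanSpace ℝ (Fin 2))))
    (hMseg : M ∈ segment ℝ A N) (hNseg : N ∈ segment ℝ A B) :
    dist v N ≤ dist A B *
      Real.tan (∠ O A B + Real.arcsin (2 * ε / (dist O A - 2 * ε))) := by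
  set δ := Real.arcsin (2 * ε / (dist O A - 2 * ε))
  have hvM : v ≠ M := by
    rintro rfl
    exact hv hMline
  obtain ⟨c, hc⟩ := Collinear.exists_vsub_eq_smul_vsub hvq hvM hcol hMcol
  simp only [vsub_eq_sub] at hc
  have hpq : ‖(p - q) - (O - A)‖ ≤ 2 * ε := by
    rw [dist_eq_norm] at hp hq
    calc ‖(p - q) - (O - A)‖ = ‖(p - O) - (q - A)‖ := by congr 1; abel
      _ ≤ ‖p - O‖ + ‖q - A‖ := norm_sub_le _ _
      _ ≤ 2 * ε := by linarith
  have hpqδ : InnerProductGeometry.angle (p - q) (O - A) ≤ δ := by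
    have hlt := hpq.trans_lt hm
    rw [dist_eq_norm] at hlt
    refine (InnerProductGeometry.angle_le_arcsin_norm_sub_div hlt).trans ?_
    rw [← dist_eq_norm O A]
    exact Real.arcsin_le_arcsin (div_le_div₀ (by positivity) hpq (by linarith) (by linarith))
  have hpqAB : InnerProductGeometry.angle (p - q) (B - A) ≤ ∠ O A B + δ := by
    have := InnerProductGeometry.angle_le_angle_add_angle (p - q) (O - A) (B - A)
    have : ∠ O A B = InnerProductGeometry.angle (O - A) (B - A) := rfl
    linarith
  have hpos := InnerProductGeometry.inner_pos_of_angle_lt_pi_div_two (hpqAB.trans_lt hβδ)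
  have hperp : inner ℝ (B - A) (v - N) = 0 := by
    have h := vsub_orthogonalProjection_mem_direction_orthogonal (affineSpan ℝ {A, B}) v
    rw [← hN] at h
    refine (Submodule.mem_orthogonal _ _).1 h _ ?_
    rw [direction_affineSpan]
    exact vsub_rev_mem_vectorSpan_pair ℝ A B
  obtain ⟨s, hs0, hs1, hs⟩ : ∃ s : ℝ, 0 ≤ s ∧ s ≤ 1 ∧ N - M = s • (B - A) := by
    rw [segment_eq_image'] at hMseg hNseg
    obtain ⟨a, ⟨ha0, ha1⟩, rfl⟩ := hNseg
    obtain ⟨μ, ⟨hμ0, hμ1⟩, rfl⟩ := hMseg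
    refine ⟨(1 - μ) * a, mul_nonneg (by linarith) ha0, by nlinarith, ?_⟩
    simp only
    module
  have hvMsum : v - M = (N - M) + (v - N) := by abel
  have hinner : inner ℝ (p - q) (B - A) = c * (s * ‖B - A‖ ^ 2) := by
    rw [hc, hvMsum, inner_smul_left, inner_add_left, hs, inner_smul_left,
      real_inner_self_eq_norm_sq, real_inner_comm, hperp]
    simp
  rw [hinner] at hpos
  have hspos : 0 < s := hs0.lt_of_ne' (by rintro rfl; simp at hpos)
  have hcpos : 0 < c := pos_of_mul_pos_left hpos (by positivity)
  have hAB : B - A ≠ 0 := by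
    intro h
    simp [h] at hpos
  have hangle : InnerProductGeometry.angle (N - M) ((N - M) + (v - N)) ≤ ∠ O A B + δ := by
    rwa [← hvMsum, InnerProductGeometry.angle_comm, hs,
      InnerProductGeometry.angle_smul_right_of_pos _ _ hspos,
      ← InnerProductGeometry.angle_smul_left_of_pos _ _ hcpos, ← hc]
  have htan := InnerProductGeometry.tan_angle_add_mul_norm_of_inner_eq_zero
    (x := N - M) (y := v - N) (by rw [hs, inner_smul_left, hperp, mul_zero])
    (Or.inl (by rw [hs]; exact smul_ne_zero hspos.ne' hAB))
  have hNM : ‖N - M‖ ≤ dist A B := by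
    rw [hs, norm_smul, Real.norm_of_nonneg hs0, dist_comm, dist_eq_norm]
    exact mul_le_of_le_one_left (norm_nonneg _) hs1
  have hangle0 := InnerProductGeometry.angle_nonneg (N - M) ((N - M) + (v - N))
  have hpi := Real.pi_pos
  have htan_le := Real.strictMonoOn_tan.monotoneOn ⟨by linarith, hangle.trans_lt hβδ⟩
    ⟨by linarith, hβδ⟩ hangle
  rw [dist_eq_norm v N, ← htan, mul_comm]
  exact mul_le_mul hNM htan_le
    (Real.tan_nonneg_of_nonneg_of_le_pi_div_two hangle0 (hangle.trans hβδ.le)) dist_nonneg
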